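/- arXiv:2211.00443 — 2 statements merged into one kernel-verified Lean document; each statement's English description precedes it below -/
import Mathlib

section
/- Let δ₁, δ₂ ∈ ℝ with δ₂ ≠ 0 and let α, β, γ ∈ ℝ. Then the system of equations α·(8δ₁ + δ₂(4 + β²)) = 0, β·(8δ₁ + δ₂(4 + α² + γ²)) = 0, γ·(8δ₁ + δ₂(4 + β²)) = 0 holds if and only if at least one of the following is true: (i) α = β = γ = 0; (ii) β = 0 and 2δ₁ + δ₂ = 0; (iii) α = γ = 0 and 2δ₁ + δ₂ = 0; (iv) δ₂·β² = −4(2δ₁ + δ₂) and δ₂·(α² + γ²) = −4(2δ₁ + δ₂). -/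
/-- Algebraic classification of left-invariant interpolating sesqui-harmonic
vector fields `X = α e₁ + β e₂ + γ e₃` on the Heisenberg group `Nil`. -/
theorem nil_sesquiharmonic_vector_field_classification
    (δ₁ δ₂ : ℝ) (hδ₂ : δ₂ ≠ 0) (α β γ : ℝ) :
    (α * (8 * δ₁ + δ₂ * (4 + β ^ 2)) = 0 ∧
     β * (8 * δ₁ + δ₂ * (4 + α ^ 2 + γ ^ 2)) = 0 ∧
     γ * (8 * δ₁ + δ₂ * (4 + β ^ 2)) = 0) ↔
    ((α = 0 ∧ β = 0 ∧ γ = 0) ∨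
     (β = 0 ∧ 2 * δ₁ + δ₂ = 0) ∨
     (α = 0 ∧ γ = 0 ∧ 2 * δ₁ + δ₂ = 0) ∨
     (δ₂ * β ^ 2 = -(4 * (2 * δ₁ + δ₂)) ∧
      δ₂ * (α ^ 2 + γ ^ 2) = -(4 * (2 * δ₁ + δ₂)))) := by
  constructor
  · rintro ⟨hα, hβ, hγ⟩
    by_cases h : 8 * δ₁ + δ₂ * (4 + β ^ 2) = 0
    · rcases mul_eq_zero.mp hβ with rfl | h'
      · exact Or.inr (Or.inl ⟨rfl, by linarith⟩)
      · exact Or.inr (Or.inr (Or.inr ⟨by linarith, by linarith⟩))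
    · obtain rfl := (mul_eq_zero.mp hα).resolve_right h
      obtain rfl := (mul_eq_zero.mp hγ).resolve_right h
      rcases mul_eq_zero.mp hβ with rfl | h'
      · exact Or.inl ⟨rfl, rfl, rfl⟩
      · exact Or.inr (Or.inr (Or.inl ⟨rfl, rfl, by linarith⟩))
  · rintro (⟨rfl, rfl, rfl⟩ | ⟨rfl, h⟩ | ⟨rfl, rfl, h⟩ | ⟨h₁, h₂⟩)
    · simp
    · exact ⟨by linear_combination 4 * α * h, by ring, by linear_combination 4 * γ * h⟩
    · exact ⟨by ring, by linear_combination 4 * β * h, by ring⟩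
    · exact ⟨by linear_combination α * h₁, by linear_combination β * h₂,
        by linear_combination γ * h₁⟩
end

section
/- Let δ₁, δ₂ ∈ ℝ with δ₂ ≠ 0 and let α, β, γ ∈ ℝ. Then the five equations α·(8δ₁ + δ₂(4 + β²)) = 0, β·(8δ₁ + δ₂(4 + α² + γ²)) = 0, γ·(8δ₁ + δ₂(4 + β²)) = 0, β·γ·(4δ₁ + δ₂(8 + α² + γ² − 2β²)) = 0 and α·β·(4δ₁ + δ₂(8 + α² + γ² − 2β²)) = 0 all hold if and only if at least one of the following is true: (i) α = β = γ = 0; (ii) β = 0 and 2δ₁ + δ₂ = 0; (iii) α = γ = 0 and 2δ₁ + δ₂ = 0; (iv) δ₂·β² = −4(2δ₁ + δ₂), δ₂·(α² + γ²) = −4(2δ₁ + δ₂) and δ₁ + δ₂ = 0. -/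
/-- Algebraic classification of left-invariant vector fields `X = α e₁ + β e₂ + γ e₃`
on the Heisenberg group `Nil` that define interpolating sesqui-harmonic maps. -/
theorem nil_sesquiharmonic_map_classification
    (δ₁ δ₂ : ℝ) (hδ₂ : δ₂ ≠ 0) (α β γ : ℝ) :
    (α * (8 * δ₁ + δ₂ * (4 + β ^ 2)) = 0 ∧
     β * (8 * δ₁ + δ₂ * (4 + α ^ 2 + γ ^ 2)) = 0 ∧
     γ * (8 * δ₁ + δ₂ * (4 + β ^ 2)) = 0 ∧
     β * γ * (4 * δ₁ + δ₂ * (8 + α ^ 2 + γ ^ 2 - 2 * β ^ 2)) = 0 ∧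
     α * β * (4 * δ₁ + δ₂ * (8 + α ^ 2 + γ ^ 2 - 2 * β ^ 2)) = 0) ↔
    ((α = 0 ∧ β = 0 ∧ γ = 0) ∨
     (β = 0 ∧ 2 * δ₁ + δ₂ = 0) ∨
     (α = 0 ∧ γ = 0 ∧ 2 * δ₁ + δ₂ = 0) ∨
     (δ₂ * β ^ 2 = -(4 * (2 * δ₁ + δ₂)) ∧
      δ₂ * (α ^ 2 + γ ^ 2) = -(4 * (2 * δ₁ + δ₂)) ∧
      δ₁ + δ₂ = 0)) := by
  constructor
  · rintro ⟨h₁, h₂, h₃, h₄, h₅⟩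
    by_cases hβ : β = 0
    · subst hβ
      by_cases hα : α = 0
      · rcases mul_eq_zero.mp h₃ with hγ | h
        · exact Or.inl ⟨hα, rfl, hγ⟩
        · exact Or.inr (Or.inl ⟨rfl, by linarith⟩)
      · have h := (mul_eq_zero.mp h₁).resolve_left hα
        exact Or.inr (Or.inl ⟨rfl, by linarith⟩)
    · have hαγ := (mul_eq_zero.mp h₂).resolve_left hβ
      by_cases h₀ : α = 0 ∧ γ = 0
      · obtain ⟨rfl, rfl⟩ := h₀
        exact Or.inr (Or.inr (Or.inl ⟨rfl, rfl, by linarith⟩))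
      · obtain ⟨hβ₂, h⟩ : 8 * δ₁ + δ₂ * (4 + β ^ 2) = 0 ∧
            4 * δ₁ + δ₂ * (8 + α ^ 2 + γ ^ 2 - 2 * β ^ 2) = 0 := by
          by_cases hα : α = 0
          · have hγ : γ ≠ 0 := fun hγ => h₀ ⟨hα, hγ⟩
            exact ⟨(mul_eq_zero.mp h₃).resolve_left hγ,
              (mul_eq_zero.mp h₄).resolve_left (mul_ne_zero hβ hγ)⟩
          · exact ⟨(mul_eq_zero.mp h₁).resolve_left hα,
              (mul_eq_zero.mp h₅).resolve_left (mul_ne_zero hα hβ)⟩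
        exact Or.inr (Or.inr (Or.inr ⟨by linarith, by linarith, by linarith⟩))
  · rintro (⟨rfl, rfl, rfl⟩ | ⟨rfl, h⟩ | ⟨rfl, rfl, h⟩ | ⟨hβ, hαγ, h⟩)
    · simp
    · have h' : 8 * δ₁ + δ₂ * (4 + (0 : ℝ) ^ 2) = 0 := by linarith
      simp only [h', mul_zero, zero_mul, and_self]
    · have h' : 8 * δ₁ + δ₂ * (4 + (0 : ℝ) ^ 2 + 0 ^ 2) = 0 := by linarith
      simp only [h', mul_zero, zero_mul, and_self]
    · have h₁ : 8 * δ₁ + δ₂ * (4 + β ^ 2) = 0 := by linarith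
      have h₂ : 8 * δ₁ + δ₂ * (4 + α ^ 2 + γ ^ 2) = 0 := by linarith
      have h₃ : 4 * δ₁ + δ₂ * (8 + α ^ 2 + γ ^ 2 - 2 * β ^ 2) = 0 := by linarith
      simp only [h₁, h₂, h₃, mul_zero, and_self]
end
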